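/- (Bound on the size of greedily built pseudo-neighborhoods.) Let u ∈ V, let τ ∈ (0,1], and let j_1, …, j_r be distinct nodes of V∖{u} such that for every k ∈ {1,…,r} the average conditional influence satisfies ν̄(u, j_k, {j_1,…,j_{k−1}}) ≥ τ. Then r ≤ 2/τ². -/

import Mathlib

noncomputable section

open Real Finset

/-- The spin value (±1) associated to a Boolean. -/
def spin (b : Bool) : ℝ := if b then 1 else -1

/-- The energy (Hamiltonian, without normalization) of a configuration of the Ising model:
`Σ_{{i,j}∈E} θ_{ij} x_i x_j + Σ_{i∈V} θ_i x_i`, where the sum over edges is written as half the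
sum over ordered adjacent pairs (the edge couplings are symmetric). -/
def energy {p : ℕ} (G : SimpleGraph (Fin p)) [DecidableRel G.Adj]
    (θe : Fin p → Fin p → ℝ) (θv : Fin p → ℝ) (x : Fin p → Bool) : ℝ :=
  (∑ i, ∑ j, if G.Adj i j then θe i j * spin (x i) * spin (x j) else 0) / 2
    + ∑ i, θv i * spin (x i)

/-- The Ising model probability mass function
`P(x) = exp(Σ_{{i,j}∈E} θ_{ij} x_i x_j + Σ_{i∈V} θ_i x_i − Φ(θ))`. -/
def isingPMF {p : ℕ} (G : SimpleGraph (Fin p)) [DecidableRel G.Adj]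
    (θe : Fin p → Fin p → ℝ) (θv : Fin p → ℝ) (x : Fin p → Bool) : ℝ :=
  Real.exp (energy G θe θv x) / ∑ y : Fin p → Bool, Real.exp (energy G θe θv y)

open Classical in
/-- Probability of an event under a pmf on configurations. -/
def prob {p : ℕ} (μ : (Fin p → Bool) → ℝ) (A : (Fin p → Bool) → Prop) : ℝ :=
  ∑ x : Fin p → Bool, if A x then μ x else 0

/-- Conditional probability `P(A | B)`. -/
def condProb {p : ℕ} (μ : (Fin p → Bool) → ℝ) (A B : (Fin p → Bool) → Prop) : ℝ :=
  prob μ (fun x => A x ∧ B x) / prob μ B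

open Classical in
/-- Conditional expectation `E[f(X) | B]`. -/
def condExp {p : ℕ} (μ : (Fin p → Bool) → ℝ) (B : (Fin p → Bool) → Prop)
    (f : (Fin p → Bool) → ℝ) : ℝ :=
  (∑ x : Fin p → Bool, if B x then μ x * f x else 0) / prob μ B

/-- The event `X_S = σ_S` (agreement with `σ` on the set `S`). -/
def agree {p : ℕ} (S : Finset (Fin p)) (σ : Fin p → Bool) (x : Fin p → Bool) : Prop :=
  ∀ i ∈ S, x i = σ i

/-- The conditional influence
`ν_{u|i;x_S} = P(X_u=+1 | X_i=+1, X_S=x_S) − P(X_u=+1 | X_i=−1, X_S=x_S)`. -/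
def condInf {p : ℕ} (μ : (Fin p → Bool) → ℝ) (u i : Fin p) (S : Finset (Fin p))
    (σ : Fin p → Bool) : ℝ :=
  condProb μ (fun x => x u = true) (fun x => x i = true ∧ agree S σ x)
    - condProb μ (fun x => x u = true) (fun x => x i = false ∧ agree S σ x)

/-- The weight `λ_i(x_S) = 2·P(X_i=+1|X_S=x_S)·P(X_i=−1|X_S=x_S)`. -/
def lamWeight {p : ℕ} (μ : (Fin p → Bool) → ℝ) (i : Fin p) (S : Finset (Fin p))
    (σ : Fin p → Bool) : ℝ :=
  2 * condProb μ (fun x => x i = true) (agree S σ)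
    * condProb μ (fun x => x i = false) (agree S σ)

/-- The average conditional influence `ν̄(u,i,S) = E[λ_i(X_S)·|ν_{u|i;X_S}|]`, the expectation
over `X_S` with law the marginal of `μ` on `S` (the integrand depends on the configuration only
through its restriction to `S`). -/
def avgInf {p : ℕ} (μ : (Fin p → Bool) → ℝ) (u i : Fin p) (S : Finset (Fin p)) : ℝ :=
  ∑ x : Fin p → Bool, μ x * (lamWeight μ i S x * |condInf μ u i S x|)

/-- `δ = (1/2)·e^{−2(βd+h)}`. -/
def deltaLB (β h : ℝ) (d : ℕ) : ℝ := (1/2) * Real.exp (-(2 * (β * d + h)))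

/-- `τ* = α²·δ^{4d+1}/(16dβ)`. -/
def tauStar (α β h : ℝ) (d : ℕ) : ℝ :=
  α ^ 2 * (deltaLB β h d) ^ (4 * d + 1) / (16 * d * β)

/-- The conditional mutual information `I(X_u ; X_i | X_S)`, computed with natural logarithms,
written as the expectation of the log-likelihood ratio
`log( P(X_u,X_i,X_S)·P(X_S) / (P(X_u,X_S)·P(X_i,X_S)) )`. -/
def condMI {p : ℕ} (μ : (Fin p → Bool) → ℝ) (u i : Fin p) (S : Finset (Fin p)) : ℝ :=
  ∑ x : Fin p → Bool, μ x * Real.log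
    ((prob μ (fun z => z u = x u ∧ z i = x i ∧ agree S x z) * prob μ (agree S x))
      / (prob μ (fun z => z u = x u ∧ agree S x z)
          * prob μ (fun z => z i = x i ∧ agree S x z)))

/-- The indicator of an event, as a real-valued function of the configuration. -/
def eventInd {p : ℕ} (A : (Fin p → Bool) → Prop) (x : Fin p → Bool) : ℝ :=
  open Classical in if A x then 1 else 0

lemma isingPMF_pos {p : ℕ} (G : SimpleGraph (Fin p)) [DecidableRel G.Adj]
    (θe : Fin p → Fin p → ℝ) (θv : Fin p → ℝ) (x : Fin p → Bool) :
    0 < isingPMF G θe θv x :=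
  div_pos (Real.exp_pos _) (Finset.sum_pos (fun _ _ => Real.exp_pos _) Finset.univ_nonempty)

lemma sum_isingPMF {p : ℕ} (G : SimpleGraph (Fin p)) [DecidableRel G.Adj]
    (θe : Fin p → Fin p → ℝ) (θv : Fin p → ℝ) : ∑ x, isingPMF G θe θv x = 1 := by
  unfold isingPMF
  rw [← Finset.sum_div]
  exact div_self (Finset.sum_pos (fun _ _ => Real.exp_pos _) Finset.univ_nonempty).ne'

section

variable {p : ℕ} {μ : (Fin p → Bool) → ℝ}

lemma prob_pos (hμ : ∀ x, 0 < μ x) {A : (Fin p → Bool) → Prop} {x : Fin p → Bool} (hx : A x) :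
    0 < prob μ A := by
  unfold prob
  refine Finset.sum_pos' (fun y _ => ?_) ⟨x, Finset.mem_univ _, by simpa [hx] using hμ x⟩
  split_ifs
  exacts [(hμ y).le, le_rfl]

lemma prob_nonneg (hμ : ∀ x, 0 < μ x) (A : (Fin p → Bool) → Prop) : 0 ≤ prob μ A := by
  unfold prob
  refine Finset.sum_nonneg fun y _ => ?_
  split_ifs
  exacts [(hμ y).le, le_rfl]

lemma prob_mono (hμ : ∀ x, 0 < μ x) {A B : (Fin p → Bool) → Prop} (hAB : ∀ x, A x → B x) :
    prob μ A ≤ prob μ B := by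
  unfold prob
  refine Finset.sum_le_sum fun y _ => ?_
  by_cases hA : A y
  · simp [hA, hAB y hA]
  · rw [if_neg hA]
    split_ifs
    exacts [(hμ y).le, le_rfl]

lemma condProb_nonneg (hμ : ∀ x, 0 < μ x) (A B : (Fin p → Bool) → Prop) :
    0 ≤ condProb μ A B :=
  div_nonneg (prob_nonneg hμ _) (prob_nonneg hμ _)

lemma condProb_le_one (hμ : ∀ x, 0 < μ x) (A B : (Fin p → Bool) → Prop) :
    condProb μ A B ≤ 1 :=
  div_le_one_of_le₀ (prob_mono hμ fun _ hx => hx.2) (prob_nonneg hμ _)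

/-- Splitting an event according to the value of the spin at `i`. -/
lemma prob_split (A : (Fin p → Bool) → Prop) (i : Fin p) :
    prob μ A = prob μ (fun x => x i = true ∧ A x) + prob μ (fun x => x i = false ∧ A x) := by
  unfold prob
  rw [← Finset.sum_add_distrib]
  refine Finset.sum_congr rfl fun x _ => ?_
  by_cases hA : A x <;> cases hxi : x i <;> simp [hxi, hA]

lemma agree_self (S : Finset (Fin p)) (x : Fin p → Bool) : agree S x x := fun _ _ => rfl

lemma agree_comm (S : Finset (Fin p)) (x y : Fin p → Bool) : agree S x y ↔ agree S y x :=
  ⟨fun h i hi => (h i hi).symm, fun h i hi => (h i hi).symm⟩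

lemma agree_congr {S : Finset (Fin p)} {x y : Fin p → Bool} (h : agree S x y) :
    agree S x = agree S y :=
  funext fun _ => propext
    ⟨fun hz i hi => (hz i hi).trans (h i hi).symm, fun hz i hi => (hz i hi).trans (h i hi)⟩

lemma agree_insert (S : Finset (Fin p)) (i : Fin p) (x : Fin p → Bool) :
    agree (insert i S) x = fun y => y i = x i ∧ agree S x y := by
  funext y
  simp [agree]

/-- Tower property: against functions of `X_S`, the indicator of `A` may be replaced by its
conditional probability given `X_S`. -/
lemma sum_condProb_mul (hμ : ∀ x, 0 < μ x) (A : (Fin p → Bool) → Prop) (S : Finset (Fin p))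
    (g : (Fin p → Bool) → ℝ) (hg : ∀ x y, agree S x y → g x = g y) :
    ∑ x, μ x * (condProb μ A (agree S x) * g x) = ∑ x, μ x * (eventInd A x * g x) := by
  classical
  have key : ∀ x, μ x * (condProb μ A (agree S x) * g x) =
      ∑ y, if agree S x y then μ y * eventInd A y * g y * (μ x / prob μ (agree S y)) else 0 := by
    intro x
    rw [condProb, prob, Finset.sum_div, Finset.sum_mul, Finset.mul_sum]
    refine Finset.sum_congr rfl fun y _ => ?_
    by_cases hxy : agree S x y
    · rw [if_pos hxy, hg x y hxy, agree_congr hxy]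
      by_cases hA : A y
      · simp [hA, eventInd, agree_self]
        ring
      · simp [hA, eventInd]
    · simp [hxy]
  rw [Finset.sum_congr rfl fun x _ => key x, Finset.sum_comm]
  refine Finset.sum_congr rfl fun y _ => ?_
  have hZ : prob μ (agree S y) ≠ 0 := (prob_pos hμ (agree_self S y)).ne'
  calc ∑ x, (if agree S x y then μ y * eventInd A y * g y * (μ x / prob μ (agree S y)) else 0)
      = μ y * eventInd A y * g y * (prob μ (agree S y) / prob μ (agree S y)) := by
        conv_rhs => rw [prob, Finset.sum_div, Finset.mul_sum]
        refine Finset.sum_congr rfl fun x _ => ?_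
        by_cases hxy : agree S x y
        · have hyx := (agree_comm S x y).1 hxy
          simp [hxy, hyx, prob]
        · have hyx : ¬ agree S y x := fun h => hxy ((agree_comm S y x).1 h)
          simp [hxy, hyx]
    _ = μ y * (eventInd A y * g y) := by rw [div_self hZ]; ring

/-- The second moment of the conditional probability of `A` given `X_S`. -/
def condProbSqMean (μ : (Fin p → Bool) → ℝ) (A : (Fin p → Bool) → Prop) (S : Finset (Fin p)) : ℝ :=
  ∑ x, μ x * condProb μ A (agree S x) ^ 2

lemma condProbSqMean_nonneg (hμ : ∀ x, 0 < μ x) (A : (Fin p → Bool) → Prop)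
    (S : Finset (Fin p)) : 0 ≤ condProbSqMean μ A S :=
  Finset.sum_nonneg fun x _ => mul_nonneg (hμ x).le (sq_nonneg _)

lemma condProbSqMean_le_one (hμ : ∀ x, 0 < μ x) (hμ1 : ∑ x, μ x = 1)
    (A : (Fin p → Bool) → Prop) (S : Finset (Fin p)) : condProbSqMean μ A S ≤ 1 := by
  rw [← hμ1]
  exact Finset.sum_le_sum fun x _ => mul_le_of_le_one_right (hμ x).le
    (pow_le_one₀ (condProb_nonneg hμ _ _) (condProb_le_one hμ _ _))

/-- Pythagoras for the martingale of conditional probabilities. -/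
lemma sum_sq_sub_condProb (hμ : ∀ x, 0 < μ x) (A : (Fin p → Bool) → Prop)
    {S T : Finset (Fin p)} (hST : S ⊆ T) :
    ∑ x, μ x * (condProb μ A (agree T x) - condProb μ A (agree S x)) ^ 2 =
      condProbSqMean μ A T - condProbSqMean μ A S := by
  have h₁ := sum_condProb_mul hμ A S (fun x => condProb μ A (agree S x))
    fun x y hxy => by rw [agree_congr hxy]
  have h₂ := sum_condProb_mul hμ A T (fun x => condProb μ A (agree S x))
    fun x y hxy => by rw [agree_congr fun i hi => hxy i (hST hi)]
  have h₃ : ∑ x, μ x * (condProb μ A (agree T x) - condProb μ A (agree S x)) ^ 2 =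
      condProbSqMean μ A T + condProbSqMean μ A S
        - 2 * ∑ x, μ x * (condProb μ A (agree T x) * condProb μ A (agree S x)) := by
    rw [condProbSqMean, condProbSqMean, Finset.mul_sum, ← Finset.sum_add_distrib,
      ← Finset.sum_sub_distrib]
    exact Finset.sum_congr rfl fun x _ => by ring
  have h₄ : condProbSqMean μ A S =
      ∑ x, μ x * (condProb μ A (agree S x) * condProb μ A (agree S x)) :=
    Finset.sum_congr rfl fun x _ => by ring
  rw [h₃, h₂, ← h₁, ← h₄]
  ring

/-- The event `X_i = b`, `X_S = x_S` has positive probability when `i ∉ S`. -/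
lemma prob_eq_and_agree_pos (hμ : ∀ x, 0 < μ x) {i : Fin p} {S : Finset (Fin p)} (hi : i ∉ S)
    (b : Bool) (x : Fin p → Bool) : 0 < prob μ (fun y => y i = b ∧ agree S x y) := by
  refine prob_pos hμ (x := Function.update x i b) ⟨by simp, fun k hk => ?_⟩
  have hki : k ≠ i := fun h => hi (h ▸ hk)
  simp [hki]

/-- The martingale increment when the spin at `i` is revealed. -/
lemma abs_condProb_insert_sub (hμ : ∀ x, 0 < μ x) (u : Fin p) {i : Fin p}
    {S : Finset (Fin p)} (hi : i ∉ S) (x : Fin p → Bool) :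
    |condProb μ (fun y => y u = true) (agree (insert i S) x)
        - condProb μ (fun y => y u = true) (agree S x)| =
      eventInd (fun y => y i = true) x
          * (condProb μ (fun y => y i = false) (agree S x) * |condInf μ u i S x|)
        + eventInd (fun y => y i = false) x
          * (condProb μ (fun y => y i = true) (agree S x) * |condInf μ u i S x|) := by
  have hP := prob_eq_and_agree_pos hμ hi true x
  have hQ := prob_eq_and_agree_pos hμ hi false x
  have hsplit := prob_split (μ := μ) (agree S x) i
  have hsplitA := prob_split (μ := μ) (fun y => y u = true ∧ agree S x y) i
  have hcomm : ∀ b : Bool, (fun y : Fin p → Bool => y i = b ∧ y u = true ∧ agree S x y) =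
      fun y => y u = true ∧ y i = b ∧ agree S x y :=
    fun b => funext fun _ => propext and_left_comm
  rw [hcomm, hcomm] at hsplitA
  have hp := condProb_nonneg hμ (fun y => y i = true) (agree S x)
  have hq := condProb_nonneg hμ (fun y => y i = false) (agree S x)
  rw [agree_insert]
  cases hxi : x i
  · have hdiff : condProb μ (fun y => y u = true) (fun y => y i = false ∧ agree S x y)
        - condProb μ (fun y => y u = true) (agree S x) =
        -(condProb μ (fun y => y i = true) (agree S x) * condInf μ u i S x) := by
      simp only [condInf, condProb]
      rw [hsplit, hsplitA]
      field_simp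
      ring
    rw [hdiff, abs_neg, abs_mul, abs_of_nonneg hp]
    simp [eventInd, hxi]
  · have hdiff : condProb μ (fun y => y u = true) (fun y => y i = true ∧ agree S x y)
        - condProb μ (fun y => y u = true) (agree S x) =
        condProb μ (fun y => y i = false) (agree S x) * condInf μ u i S x := by
      simp only [condInf, condProb]
      rw [hsplit, hsplitA]
      field_simp
      ring
    rw [hdiff, abs_mul, abs_of_nonneg hq]
    simp [eventInd, hxi]

/-- The average conditional influence is the mean absolute martingale increment. -/
lemma avgInf_eq_sum_abs (hμ : ∀ x, 0 < μ x) (u : Fin p) {i : Fin p}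
    {S : Finset (Fin p)} (hi : i ∉ S) :
    avgInf μ u i S = ∑ x, μ x * |condProb μ (fun y => y u = true) (agree (insert i S) x)
        - condProb μ (fun y => y u = true) (agree S x)| := by
  have hcongr : ∀ (b : Bool) (x y : Fin p → Bool), agree S x y →
      condProb μ (fun z => z i = b) (agree S x) * |condInf μ u i S x| =
        condProb μ (fun z => z i = b) (agree S y) * |condInf μ u i S y| := by
    intro b x y hxy
    simp only [condInf, agree_congr hxy]
  simp_rw [abs_condProb_insert_sub hμ u hi, mul_add]
  rw [Finset.sum_add_distrib, ← sum_condProb_mul hμ _ S _ (hcongr false),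
    ← sum_condProb_mul hμ _ S _ (hcongr true), ← Finset.sum_add_distrib]
  exact Finset.sum_congr rfl fun x _ => by rw [lamWeight]; ring

lemma sq_avgInf_le (hμ : ∀ x, 0 < μ x) (hμ1 : ∑ x, μ x = 1) (u : Fin p) {i : Fin p}
    {S : Finset (Fin p)} (hi : i ∉ S) :
    avgInf μ u i S ^ 2 ≤ condProbSqMean μ (fun y => y u = true) (insert i S)
      - condProbSqMean μ (fun y => y u = true) S := by
  rw [← sum_sq_sub_condProb hμ _ (Finset.subset_insert i S), avgInf_eq_sum_abs hμ u hi]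
  simpa only [sq_abs] using Real.pow_arith_mean_le_arith_mean_pow Finset.univ μ
    (fun x => |condProb μ (fun y => y u = true) (agree (insert i S) x)
        - condProb μ (fun y => y u = true) (agree S x)|)
    (fun x _ => (hμ x).le) hμ1 (fun _ _ => abs_nonneg _) 2

end

/-- bound on the size of greedily built pseudo-neighborhoods. -/
theorem stmt14
    {p d : ℕ} (G : SimpleGraph (Fin p)) [DecidableRel G.Adj]
    (θe : Fin p → Fin p → ℝ) (θv : Fin p → ℝ) (α β h : ℝ)
    (hα : 0 < α) (hαβ : α ≤ β) (hh : 0 ≤ h)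
    (hdeg : ∀ v, G.degree v ≤ d)
    (hsym : ∀ i j, θe i j = θe j i)
    (hedge : ∀ i j, G.Adj i j → α ≤ |θe i j| ∧ |θe i j| ≤ β)
    (hnonedge : ∀ i j, ¬ G.Adj i j → θe i j = 0)
    (hfield : ∀ i, |θv i| ≤ h)
    (u : Fin p) (τ : ℝ) (hτ0 : 0 < τ) (hτ1 : τ ≤ 1)
    (r : ℕ) (j : Fin r → Fin p) (hinj : Function.Injective j) (hju : ∀ k, j k ≠ u)
    (hgreedy : ∀ k : Fin r,
      avgInf (isingPMF G θe θv) u (j k)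
          ((Finset.univ.filter (fun m => m < k)).image j) ≥ τ) :
    (r : ℝ) ≤ 2 / τ ^ 2 := by
  set μ := isingPMF G θe θv
  have hμ : ∀ x, 0 < μ x := isingPMF_pos G θe θv
  have hμ1 : ∑ x, μ x = 1 := sum_isingPMF G θe θv
  have hstep : ∀ n : ℕ, n ≤ r → n * τ ^ 2 ≤ condProbSqMean μ (fun y => y u = true)
      ((Finset.univ.filter (fun m : Fin r => (m : ℕ) < n)).image j) := by
    intro n
    induction n with
    | zero => intro _; simpa using condProbSqMean_nonneg hμ _ _
    | succ n ih =>
      intro hn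
      set k : Fin r := ⟨n, hn⟩
      set S := (Finset.univ.filter (fun m : Fin r => (m : ℕ) < n)).image j
      have hk : j k ∉ S := by
        simp only [S, Finset.mem_image, Finset.mem_filter, Finset.mem_univ, true_and, not_exists,
          not_and]
        intro m hm hmk
        rw [hinj hmk] at hm
        exact lt_irrefl n hm
      have hins : (Finset.univ.filter (fun m : Fin r => (m : ℕ) < n + 1)).image j =
          insert (j k) S := by
        rw [← Finset.image_insert]
        congr 1
        ext m
        simp only [Finset.mem_filter, Finset.mem_univ, true_and, Finset.mem_insert, Fin.ext_iff, k]
        omega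
      have hτ : τ ^ 2 ≤ avgInf μ u (j k) S ^ 2 := pow_le_pow_left₀ hτ0.le (hgreedy k) 2
      have hinc := sq_avgInf_le hμ hμ1 u hk
      have hprev := ih (by omega)
      rw [hins]
      push_cast
      linarith
  have hr := (hstep r le_rfl).trans (condProbSqMean_le_one hμ hμ1 _ _)
  rw [le_div_iff₀ (by positivity)]
  linarith
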